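/- arXiv:2312.06981 — 2 statements merged into one kernel-verified Lean document; each statement's English description precedes it below -/
import Mathlib

section
/- Let β be a Pisot or Salem number with β > √φ, where φ = (1+√5)/2 is the golden ratio. Then for every integer k ≥ 1, the number γ_k := Σ_{n≥1} t(n^k)/β^n does not belong to the field ℚ(β). -/
/-- The Thue–Morse indicator: `thueMorse n = 1` if the number of ones in the
binary expansion of `n` is odd, and `0` if it is even. -/
def thueMorse (n : ℕ) : ℕ := (Nat.digits 2 n).sum % 2

/-- A real number `β` is a Pisot or Salem number if `β > 1`, `β` is an algebraic
integer, and every Galois conjugate of `β` other than `β` itself has absolute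
value at most `1`. -/
def IsPisotOrSalem (β : ℝ) : Prop :=
  1 < β ∧ IsIntegral ℤ β ∧
    ∀ z : ℂ, Polynomial.aeval z (minpoly ℚ β) = 0 → z ≠ (β : ℂ) → ‖z‖ ≤ 1

open Finset

theorem thueMorse_le_one (n : ℕ) : thueMorse n ≤ 1 := by
  unfold thueMorse; omega

/-- The Thue–Morse indicator with values in `ZMod 2`. -/
def tmParity (n : ℕ) : ZMod 2 := (thueMorse n : ZMod 2)

theorem tmParity_eq_digits_sum (n : ℕ) : tmParity n = ((Nat.digits 2 n).sum : ZMod 2) := by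
  rw [tmParity, thueMorse, ZMod.natCast_mod]

theorem thueMorse_eq_iff {m n : ℕ} : thueMorse m = thueMorse n ↔ tmParity m = tmParity n := by
  have hm := thueMorse_le_one m
  have hn := thueMorse_le_one n
  rw [tmParity, tmParity, ZMod.natCast_eq_natCast_iff']
  omega

theorem tmParity_zero : tmParity 0 = 0 := by simp [tmParity_eq_digits_sum]

theorem tmParity_one : tmParity 1 = 1 := by simp [tmParity_eq_digits_sum]

theorem tmParity_add_two_mul {b : ℕ} (hb : b < 2) (n : ℕ) :
    tmParity (b + 2 * n) = b + tmParity n := by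
  rcases Nat.eq_zero_or_pos (b + 2 * n) with h | h
  · obtain ⟨rfl, rfl⟩ : b = 0 ∧ n = 0 := by omega
    simp [tmParity_zero]
  · rw [tmParity_eq_digits_sum, tmParity_eq_digits_sum,
      Nat.digits_add 2 one_lt_two b n hb (by omega)]
    simp

theorem tmParity_add_two_pow_mul {K : ℕ} : ∀ {x : ℕ}, x < 2 ^ K → ∀ y : ℕ,
    tmParity (x + 2 ^ K * y) = tmParity x + tmParity y := by
  induction K with
  | zero =>
    intro x hx y
    obtain rfl : x = 0 := by simpa using hx
    simp [tmParity_zero]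
  | succ K ih =>
    intro x hx y
    have hx' : x / 2 < 2 ^ K := by rw [pow_succ] at hx; omega
    have hb : x % 2 < 2 := Nat.mod_lt _ two_pos
    have h1 : x + 2 ^ (K + 1) * y = x % 2 + 2 * (x / 2 + 2 ^ K * y) := by
      rw [pow_succ]; linarith [Nat.mod_add_div x 2]
    have h2 : tmParity x = (x % 2 : ℕ) + tmParity (x / 2) := by
      rw [← tmParity_add_two_mul hb, Nat.mod_add_div]
    rw [h1, tmParity_add_two_mul hb, ih hx', h2, add_assoc]

theorem tmParity_sum_two_pow_mul {K : ℕ} (m : ℕ) : ∀ c : ℕ → ℕ, (∀ i < m, c i < 2 ^ K) →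
    tmParity (∑ i ∈ range m, 2 ^ (K * i) * c i) = ∑ i ∈ range m, tmParity (c i) := by
  induction m with
  | zero => simp [tmParity_zero]
  | succ m ih =>
    intro c hc
    rw [sum_range_succ', sum_range_succ', ← ih (fun i => c (i + 1)) fun i hi => hc _ (by omega),
      add_comm, add_comm _ (tmParity (c 0)), ← tmParity_add_two_pow_mul (hc 0 (by omega)), mul_sum]
    simp only [mul_zero, pow_zero, one_mul, mul_add, mul_one, pow_add]
    congr 2
    exact sum_congr rfl fun i _ => by ring

theorem tmParity_two_pow_sub_one (e : ℕ) : tmParity (2 ^ e - 1) = e := by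
  induction e with
  | zero => simp [tmParity_zero]
  | succ e ih =>
    have h : 2 ^ (e + 1) - 1 = 1 + 2 * (2 ^ e - 1) := by
      have := Nat.one_le_two_pow (n := e)
      rw [pow_succ]; omega
    rw [h, tmParity_add_two_mul one_lt_two, ih]
    push_cast; ring

/-- Incrementing `x` changes its digit sum by `1 - e`, where `e` is the number of trailing ones. -/
theorem tmParity_succ_of_eq {x e y : ℕ} (h : x + 1 = 2 ^ e * (2 * y + 1)) :
    tmParity (x + 1) = tmParity x + e + 1 := by
  have hp := Nat.one_le_two_pow (n := e)
  have hx : x = (2 ^ e - 1) + 2 ^ e * (2 * y) := by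
    rw [mul_add, mul_one] at h; omega
  have h1 : tmParity (x + 1) = 1 + tmParity y := by
    have h0 := tmParity_add_two_pow_mul (K := e) (x := 0) (by positivity) (2 * y + 1)
    have h2 := tmParity_add_two_mul one_lt_two y
    rw [zero_add, tmParity_zero, zero_add] at h0
    rw [h, h0, add_comm (2 * y), h2]; simp
  have h2 : tmParity x = e + tmParity y := by
    have h2 := tmParity_add_two_mul two_pos y
    rw [zero_add] at h2
    rw [hx, tmParity_add_two_pow_mul (by omega), tmParity_two_pow_sub_one, h2]; simp
  rw [h1, h2]
  linear_combination -(e : ZMod 2) * (CharTwo.two_eq_zero : (2 : ZMod 2) = 0)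

/-- The tail `∑ s (N + j) β⁻ʲ` of the expansion with digits `s` in base `β = x⁻¹`. -/
noncomputable def digitTail (s : ℕ → ℕ) (x : ℝ) (N : ℕ) : ℝ := ∑' j : ℕ, (s (N + j) : ℝ) * x ^ j

section digitTail

variable {s : ℕ → ℕ} {x : ℝ}

theorem summable_digitTail (hs : ∀ n, s n ≤ 1) (hx0 : 0 ≤ x) (hx1 : x < 1) (N : ℕ) :
    Summable fun j : ℕ => (s (N + j) : ℝ) * x ^ j := by
  refine Summable.of_nonneg_of_le (fun j => by positivity) (fun j => ?_)
    (summable_geometric_of_lt_one hx0 hx1)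
  have : (s (N + j) : ℝ) ≤ 1 := by exact_mod_cast hs _
  exact mul_le_of_le_one_left (by positivity) this

theorem digitTail_nonneg (hx0 : 0 ≤ x) (N : ℕ) : 0 ≤ digitTail s x N :=
  tsum_nonneg fun _ => by positivity

theorem digitTail_le (hs : ∀ n, s n ≤ 1) (hx0 : 0 ≤ x) (hx1 : x < 1) (N : ℕ) :
    digitTail s x N ≤ (1 - x)⁻¹ := by
  rw [← tsum_geometric_of_lt_one hx0 hx1]
  refine (summable_digitTail hs hx0 hx1 N).tsum_le_tsum (fun j => ?_)
    (summable_geometric_of_lt_one hx0 hx1)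
  have : (s (N + j) : ℝ) ≤ 1 := by exact_mod_cast hs _
  exact mul_le_of_le_one_left (by positivity) this

theorem digitTail_eq_sum_add (hs : ∀ n, s n ≤ 1) (hx0 : 0 ≤ x) (hx1 : x < 1) (N L : ℕ) :
    digitTail s x N =
      ∑ j ∈ Finset.range L, (s (N + j) : ℝ) * x ^ j + x ^ L * digitTail s x (N + L) := by
  rw [digitTail, ← (summable_digitTail hs hx0 hx1 N).sum_add_tsum_nat_add L, digitTail,
    ← tsum_mul_left]
  congr 2
  ext j
  rw [pow_add, show N + (j + L) = N + L + j by ring]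
  ring

theorem digitTail_sub_of_agree (hs : ∀ n, s n ≤ 1) (hx0 : 0 ≤ x) (hx1 : x < 1) {N N' L : ℕ}
    (h : ∀ j < L, s (N + j) = s (N' + j)) :
    digitTail s x N - digitTail s x N' =
      x ^ L * (digitTail s x (N + L) - digitTail s x (N' + L)) := by
  rw [digitTail_eq_sum_add hs hx0 hx1 N L, digitTail_eq_sum_add hs hx0 hx1 N' L,
    Finset.sum_congr rfl fun j hj => by rw [h j (Finset.mem_range.1 hj)]]
  ring

theorem abs_digitTail_sub_le (hs : ∀ n, s n ≤ 1) (hx0 : 0 ≤ x) (hx1 : x < 1) (N N' : ℕ) :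
    |digitTail s x N - digitTail s x N'| ≤ (1 - x)⁻¹ := by
  have h1 := digitTail_le hs hx0 hx1 N
  have h2 := digitTail_le hs hx0 hx1 N'
  have h3 := digitTail_nonneg (s := s) hx0 N
  have h4 := digitTail_nonneg (s := s) hx0 N'
  rw [abs_le]; constructor <;> linarith

end digitTail

/-- The product of all conjugates of a nonzero algebraic integer has absolute value at least `1`. -/
theorem one_le_prod_norm_embeddings {K : Type*} [Field K] [NumberField K] {η : K}
    (hη : IsIntegral ℤ η) (h0 : η ≠ 0) : 1 ≤ ∏ σ : K →ₐ[ℚ] ℂ, ‖σ η‖ := by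
  obtain ⟨m, hm⟩ := IsIntegrallyClosed.isIntegral_iff.1 (Algebra.isIntegral_norm ℚ hη)
  have hm0 : m ≠ 0 := by
    rintro rfl
    exact h0 (Algebra.norm_eq_zero_iff.1 (by rw [← hm]; simp))
  have h := Algebra.norm_eq_prod_embeddings ℚ ℂ η
  rw [← norm_prod, ← h, ← hm]
  simp only [eq_intCast, map_intCast, Complex.norm_intCast]
  exact_mod_cast Int.one_le_abs hm0

/-- Distinct tails of an expansion of an element of `ℚ(β)` in a Pisot or Salem base `β` repel each
other polynomially. -/
theorem IsPisotOrSalem.exists_one_le_mul_abs_digitTail_sub {β : ℝ} (hβ : IsPisotOrSalem β)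
    {s : ℕ → ℕ} (hs : ∀ n, s n ≤ 1)
    (hmem : digitTail s β⁻¹ 0 ∈ IntermediateField.adjoin ℚ ({β} : Set ℝ)) :
    ∃ C : ℝ, 0 < C ∧ ∃ d : ℕ, ∀ N N' : ℕ, digitTail s β⁻¹ N ≠ digitTail s β⁻¹ N' →
      1 ≤ (C * (N + N' + 1)) ^ d * |digitTail s β⁻¹ N - digitTail s β⁻¹ N'| := by
  obtain ⟨hβ1, hint, hconj⟩ := hβ
  have hβ0 : 0 < β := by linarith
  have hx0 : 0 ≤ β⁻¹ := by positivity
  have hx1 : β⁻¹ < 1 := inv_lt_one_of_one_lt₀ hβ1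
  have hintQ : IsIntegral ℚ β := hint.tower_top
  let K := IntermediateField.adjoin ℚ ({β} : Set ℝ)
  have : FiniteDimensional ℚ K := IntermediateField.adjoin.finiteDimensional hintQ
  have : NumberField K := ⟨⟩
  let b : K := IntermediateField.AdjoinSimple.gen ℚ β
  have hb : (b : ℝ) = β := IntermediateField.AdjoinSimple.coe_gen ℚ β
  have hbint : IsIntegral ℤ b := by
    have : IsIntegral ℤ (algebraMap K ℝ b) := by
      change IsIntegral ℤ (b : ℝ); rwa [hb]
    exact (isIntegral_algebraMap_iff (algebraMap K ℝ).injective).1 this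
  let g : K := ⟨_, hmem⟩
  obtain ⟨D, hD0, hDint⟩ : ∃ D : ℤ, D ≠ 0 ∧ IsIntegral ℤ (D • g) :=
    IsAlgebraic.exists_integral_multiple
      ((IsFractionRing.isAlgebraic_iff ℤ ℚ K).2 (IsAlgebraic.of_finite ℚ g))
  obtain ⟨θ, hθz, hθs⟩ : ∃ θ : ℕ → K, θ 0 = D • g ∧
      ∀ n, θ (n + 1) = b * (θ n - D * (s n : K)) :=
    ⟨fun n => Nat.rec (D • g) (fun n y => b * (y - D * (s n : K))) n, rfl, fun _ => rfl⟩
  have hθint (n : ℕ) : IsIntegral ℤ (θ n) := by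
    induction n with
    | zero => rwa [hθz]
    | succ n ih =>
      rw [hθs]
      refine hbint.mul (ih.sub ?_)
      exact_mod_cast isIntegral_algebraMap (R := ℤ) (A := K) (x := D * (s n : ℤ))
  have hθ (n : ℕ) : ((θ n : K) : ℝ) = D * digitTail s β⁻¹ n := by
    induction n with
    | zero => simp [hθz, g]
    | succ n ih =>
      have h1 := digitTail_eq_sum_add hs hx0 hx1 n 1
      rw [hθs]
      push_cast
      rw [ih, hb, h1, Finset.sum_range_one, add_zero, pow_zero, pow_one, mul_one]
      linear_combination D * digitTail s β⁻¹ (n + 1) * mul_inv_cancel₀ hβ0.ne'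
  obtain ⟨C, hC⟩ : ∃ C : ℝ, ∀ σ : K →ₐ[ℚ] ℂ, ‖σ (θ 0)‖ ≤ C :=
    ⟨∑ σ : K →ₐ[ℚ] ℂ, ‖σ (θ 0)‖, fun σ =>
      Finset.single_le_sum (f := fun σ : K →ₐ[ℚ] ℂ => ‖σ (θ 0)‖)
        (fun _ _ => norm_nonneg _) (Finset.mem_univ σ)⟩
  let ι : K →ₐ[ℚ] ℂ := (Complex.ofRealAm.restrictScalars ℚ).comp K.val
  have hι (y : K) : ι y = ((y : ℝ) : ℂ) := rfl
  have hC0 : 0 ≤ C := (norm_nonneg _).trans (hC ι)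
  have hD1 : (0 : ℝ) < |(D : ℝ)| := by positivity
  have hsmall (σ : K →ₐ[ℚ] ℂ) (hσ : σ ≠ ι) : ‖σ b‖ ≤ 1 := by
    refine hconj _ ?_ fun h => hσ ?_
    · rw [← hb, ← IntermediateField.minpoly_eq, Polynomial.aeval_algHom_apply]
      exact (congrArg σ (minpoly.aeval ℚ b)).trans (map_zero σ)
    · refine IntermediateField.adjoin_algHom_ext ℚ fun y hy => ?_
      obtain rfl : y = β := hy
      exact h
  have hbound (σ : K →ₐ[ℚ] ℂ) (hσ : σ ≠ ι) (n : ℕ) : ‖σ (θ n)‖ ≤ C + |(D : ℝ)| * n := by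
    induction n with
    | zero => simpa using hC σ
    | succ n ih =>
      have h1 : (s n : ℝ) ≤ 1 := by exact_mod_cast hs n
      rw [hθs, map_mul, norm_mul]
      refine (mul_le_of_le_one_left (norm_nonneg _) (hsmall σ hσ)).trans ?_
      rw [map_sub, map_mul, map_intCast, map_natCast]
      refine (norm_sub_le _ _).trans ?_
      rw [norm_mul, Complex.norm_intCast, Complex.norm_natCast]
      push_cast
      nlinarith
  classical
  refine ⟨2 * C + |(D : ℝ)| + 1, by positivity, Fintype.card (K →ₐ[ℚ] ℂ), fun N N' hne => ?_⟩
  set B : ℝ := (2 * C + |(D : ℝ)| + 1) * (N + N' + 1) with hB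
  have hη0 : θ N - θ N' ≠ 0 := by
    intro h
    have h2 : ((θ N - θ N' : K) : ℝ) = 0 := by rw [h]; rfl
    push_cast at h2
    rw [hθ, hθ, ← mul_sub, mul_eq_zero, sub_eq_zero] at h2
    exact h2.elim (by exact_mod_cast hD0) hne
  have hprod := one_le_prod_norm_embeddings ((hθint N).sub (hθint N')) hη0
  rw [← Finset.mul_prod_erase _ _ (Finset.mem_univ ι)] at hprod
  have hNN : (0 : ℝ) ≤ N + N' := by positivity
  have hB1 : 1 ≤ B := by rw [hB]; nlinarith
  have hDB : |(D : ℝ)| ≤ B := by rw [hB]; nlinarith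
  have herase : ∏ σ ∈ Finset.univ.erase ι, ‖σ (θ N - θ N')‖ ≤
      B ^ (Fintype.card (K →ₐ[ℚ] ℂ) - 1) := by
    have hcard : (Finset.univ.erase ι).card = Fintype.card (K →ₐ[ℚ] ℂ) - 1 :=
      Finset.card_erase_of_mem (Finset.mem_univ ι)
    rw [← hcard]
    refine (Finset.prod_le_prod (fun _ _ => norm_nonneg _) fun σ hσ => ?_).trans_eq
      (Finset.prod_const B)
    have hσι := Finset.ne_of_mem_erase hσ
    have h1 := hbound σ hσι N
    have h2 := hbound σ hσι N'
    rw [map_sub]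
    refine (norm_sub_le _ _).trans ?_
    rw [hB]
    nlinarith
  have hι' : ‖ι (θ N - θ N')‖ ≤ B * |digitTail s β⁻¹ N - digitTail s β⁻¹ N'| := by
    rw [hι]
    push_cast
    rw [hθ, hθ, ← Complex.ofReal_sub, Complex.norm_real, ← mul_sub, Real.norm_eq_abs, abs_mul]
    exact mul_le_mul_of_nonneg_right hDB (abs_nonneg _)
  have hcard : 1 ≤ Fintype.card (K →ₐ[ℚ] ℂ) := Fintype.card_pos_iff.2 ⟨ι⟩
  calc (1 : ℝ) ≤ _ := hprod
    _ ≤ (B * |digitTail s β⁻¹ N - digitTail s β⁻¹ N'|) *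
        B ^ (Fintype.card (K →ₐ[ℚ] ℂ) - 1) :=
      mul_le_mul hι' herase (Finset.prod_nonneg fun _ _ => norm_nonneg _) (by positivity)
    _ = B ^ Fintype.card (K →ₐ[ℚ] ℂ) * |digitTail s β⁻¹ N - digitTail s β⁻¹ N'| := by
      rw [mul_right_comm, mul_pow_sub_one (by omega)]

/-- Tails agreeing on exponentially many digits coincide. -/
theorem IsPisotOrSalem.exists_forall_digitTail_eq {β : ℝ} (hβ : IsPisotOrSalem β)
    {s : ℕ → ℕ} (hs : ∀ n, s n ≤ 1)
    (hmem : digitTail s β⁻¹ 0 ∈ IntermediateField.adjoin ℚ ({β} : Set ℝ)) (c : ℕ) :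
    ∃ M₀ : ℕ, ∀ M ≥ M₀, ∀ N N' : ℕ, N ≤ 2 ^ (c * M) → N' ≤ 2 ^ (c * M) →
      (∀ j < 2 ^ M, s (N + j) = s (N' + j)) → digitTail s β⁻¹ N = digitTail s β⁻¹ N' := by
  obtain ⟨C, hC, d, hd⟩ := hβ.exists_one_le_mul_abs_digitTail_sub hs hmem
  have hβ0 : 0 < β := by linarith [hβ.1]
  have hx0 : 0 ≤ β⁻¹ := by positivity
  have hx1 : β⁻¹ < 1 := inv_lt_one_of_one_lt₀ hβ.1
  have hlim : Filter.Tendsto (fun M : ℕ => (3 * C) ^ d * (1 - β⁻¹)⁻¹ *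
      (((2 ^ M : ℕ) : ℝ) ^ (c * d) * β⁻¹ ^ (2 ^ M : ℕ))) Filter.atTop (nhds 0) := by
    have h := ((tendsto_pow_const_mul_const_pow_of_lt_one (c * d) hx0 hx1).comp
      (tendsto_pow_atTop_atTop_of_one_lt (one_lt_two (α := ℕ)))).const_mul
        ((3 * C) ^ d * (1 - β⁻¹)⁻¹)
    rwa [mul_zero] at h
  obtain ⟨M₀, hM₀⟩ := Filter.eventually_atTop.1 (hlim.eventually_lt_const one_pos)
  refine ⟨M₀, fun M hM N N' hN hN' hagree => ?_⟩
  by_contra hne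
  refine absurd (hd N N' hne) (not_le.2 (lt_of_le_of_lt ?_ (hM₀ M hM)))
  rw [digitTail_sub_of_agree hs hx0 hx1 hagree, abs_mul, abs_of_nonneg (pow_nonneg hx0 _)]
  have h1 : ((N : ℝ) + N' + 1) ≤ 3 * 2 ^ (c * M) := by
    have h2 : (N : ℝ) ≤ 2 ^ (c * M) := by exact_mod_cast hN
    have h3 : (N' : ℝ) ≤ 2 ^ (c * M) := by exact_mod_cast hN'
    have h4 : (1 : ℝ) ≤ 2 ^ (c * M) := one_le_pow₀ one_le_two
    linarith
  calc (C * ((N : ℝ) + N' + 1)) ^ d * (β⁻¹ ^ 2 ^ M *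
        |digitTail s β⁻¹ (N + 2 ^ M) - digitTail s β⁻¹ (N' + 2 ^ M)|)
      ≤ (C * (3 * 2 ^ (c * M))) ^ d * (β⁻¹ ^ 2 ^ M * (1 - β⁻¹)⁻¹) := by
        gcongr
        exact abs_digitTail_sub_le hs hx0 hx1 _ _
    _ = _ := by push_cast; ring

theorem abs_tsum_mul_pow_le {a : ℕ → ℝ} {y : ℝ} (hy0 : 0 ≤ y) (hy1 : y < 1) {L : ℕ}
    (ha : ∀ i, |a i| ≤ 1) (h0 : ∀ i < L, a i = 0) :
    |∑' i, a i * y ^ i| ≤ y ^ L * (1 - y)⁻¹ := by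
  have hle (i : ℕ) : ‖a i * y ^ i‖ ≤ y ^ i := by
    rw [norm_mul, Real.norm_eq_abs, Real.norm_of_nonneg (pow_nonneg hy0 i)]
    exact mul_le_of_le_one_left (by positivity) (ha i)
  have hsum : Summable fun i => a i * y ^ i :=
    .of_norm_bounded (summable_geometric_of_lt_one hy0 hy1) hle
  rw [← hsum.sum_add_tsum_nat_add L, Finset.sum_eq_zero fun i hi => by
    rw [h0 i (Finset.mem_range.1 hi), zero_mul], zero_add, ← Real.norm_eq_abs]
  refine tsum_of_norm_bounded ?_ fun i => hle (i + L)
  simpa only [pow_add, mul_comm] using (hasSum_geometric_of_lt_one hy0 hy1).mul_left (y ^ L)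

/-- If `x² + x⁴ < 1`, two digit sequences whose first difference is at index `1`, and which agree at
index `3` and at many even indices, have different values. -/
theorem exists_forall_digitTail_ne {s : ℕ → ℕ} (hs : ∀ n, s n ≤ 1) {x : ℝ} (hx0 : 0 < x)
    (hx : x ^ 2 + x ^ 4 < 1) :
    ∃ J : ℕ, ∀ N N' : ℕ, s (N + 1) ≠ s (N' + 1) → s (N + 3) = s (N' + 3) →
      (∀ i < J, s (N + 2 * i) = s (N' + 2 * i)) → digitTail s x N ≠ digitTail s x N' := by
  have hy0 : 0 ≤ x ^ 2 := by positivity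
  have hy1 : x ^ 2 < 1 := by nlinarith [pow_pos hx0 4]
  have hx1 : x < 1 := by nlinarith
  have hz : 0 < 1 - x ^ 2 := by linarith
  have hgap : 0 < x * (1 - (x ^ 2) ^ 2 * (1 - x ^ 2)⁻¹) := by
    refine mul_pos hx0 (sub_pos.2 ?_)
    rw [← div_eq_mul_inv, div_lt_one hz]
    nlinarith
  have hlim := (tendsto_pow_atTop_nhds_zero_of_lt_one hy0 hy1).mul_const (1 - x ^ 2)⁻¹
  rw [zero_mul] at hlim
  obtain ⟨J, hJ⟩ := (hlim.eventually_lt_const hgap).exists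
  refine ⟨J, fun N N' h1 h3 heven heq => ?_⟩
  let ε : ℕ → ℝ := fun j => (s (N + j) : ℝ) - s (N' + j)
  have hε (j : ℕ) : |ε j| ≤ 1 := by
    have a1 : (s (N + j) : ℝ) ≤ 1 := by exact_mod_cast hs _
    have a2 : (s (N' + j) : ℝ) ≤ 1 := by exact_mod_cast hs _
    have a3 : (0 : ℝ) ≤ s (N + j) := by positivity
    have a4 : (0 : ℝ) ≤ s (N' + j) := by positivity
    simp only [ε]
    rw [abs_le]; constructor <;> linarith
  have hε1 : |ε 1| = 1 := by
    have a1 := hs (N + 1)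
    have a2 := hs (N' + 1)
    rcases (by omega : s (N + 1) = 0 ∧ s (N' + 1) = 1 ∨ s (N + 1) = 1 ∧ s (N' + 1) = 0) with
      ⟨b1, b2⟩ | ⟨b1, b2⟩ <;> simp [ε, b1, b2]
  have hεy (f : ℕ → ℕ) : Summable fun i => ε (f i) * (x ^ 2) ^ i := by
    refine .of_norm_bounded (summable_geometric_of_lt_one hy0 hy1) fun i => ?_
    rw [norm_mul, Real.norm_eq_abs, Real.norm_of_nonneg (pow_nonneg hy0 i)]
    exact mul_le_of_le_one_left (by positivity) (hε _)
  have hsplit : ∑' i, ε (2 * i) * (x ^ 2) ^ i + x * ∑' i, ε (2 * i + 1) * (x ^ 2) ^ i = 0 := by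
    have hsub := (summable_digitTail hs hx0.le hx1 N).tsum_sub
      (summable_digitTail hs hx0.le hx1 N')
    change _ = digitTail s x N - digitTail s x N' at hsub
    rw [heq, sub_self] at hsub
    rw [← tsum_mul_left, ← hsub,
      ← tsum_even_add_odd (f := fun j => (s (N + j) : ℝ) * x ^ j - s (N' + j) * x ^ j)]
    · congr 1 <;> refine tsum_congr fun i => ?_
      · simp only [ε]; ring
      · simp only [ε]; ring
    · refine (hεy fun i => 2 * i).congr fun i => ?_
      simp only [ε]; ring
    · refine ((hεy fun i => 2 * i + 1).mul_left x).congr fun i => ?_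
      simp only [ε]; ring
  have hE : |∑' i, ε (2 * i) * (x ^ 2) ^ i| ≤ (x ^ 2) ^ J * (1 - x ^ 2)⁻¹ :=
    abs_tsum_mul_pow_le hy0 hy1 (fun i => hε _) fun i hi => by simp [ε, heven i hi]
  have hO : ∑' i, ε (2 * i + 1) * (x ^ 2) ^ i =
      ε 1 + ∑' i, (if i = 0 then 0 else ε (2 * i + 1)) * (x ^ 2) ^ i := by
    rw [(hεy fun i => 2 * i + 1).tsum_eq_add_tsum_ite 0]
    simp
  have hO' : |∑' i, (if i = 0 then 0 else ε (2 * i + 1)) * (x ^ 2) ^ i| ≤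
      (x ^ 2) ^ 2 * (1 - x ^ 2)⁻¹ := by
    refine abs_tsum_mul_pow_le hy0 hy1 (fun i => ?_) fun i hi => ?_
    · split_ifs
      · simp
      · exact hε _
    · interval_cases i
      · simp
      · simp [ε, h3]
  rw [hO] at hsplit
  set P := ∑' i, ε (2 * i) * (x ^ 2) ^ i
  set Q := ∑' i, (if i = 0 then 0 else ε (2 * i + 1)) * (x ^ 2) ^ i
  have h5 : |x * (ε 1 + Q)| = |P| := by
    rw [← abs_neg P]; congr 1; linarith
  have h6 : 1 - |Q| ≤ |ε 1 + Q| := by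
    have := abs_sub_abs_le_abs_sub (ε 1) (-Q)
    rwa [hε1, abs_neg, sub_neg_eq_add] at this
  rw [abs_mul, abs_of_pos hx0] at h5
  nlinarith

theorem sum_thueMorse_sign_pos {x : ℝ} (hx0 : 0 ≤ x) (hx1 : x < 1) (M : ℕ) :
    0 < ∑ j ∈ range (2 ^ M), (1 - 2 * (thueMorse j : ℝ)) * x ^ j := by
  induction M with
  | zero => simp [thueMorse]
  | succ M ih =>
    have hcompl (j : ℕ) (hj : j < 2 ^ M) :
        (1 - 2 * (thueMorse (2 ^ M + j) : ℝ)) = -(1 - 2 * (thueMorse j : ℝ)) := by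
      have hne : thueMorse (2 ^ M + j) ≠ thueMorse j := by
        rw [Ne, thueMorse_eq_iff]
        have h := tmParity_add_two_pow_mul hj 1
        rw [mul_one, tmParity_one, add_comm] at h
        simp [h]
      have h1 := thueMorse_le_one j
      have h2 := thueMorse_le_one (2 ^ M + j)
      rcases (by omega : thueMorse (2 ^ M + j) = 0 ∧ thueMorse j = 1 ∨
        thueMorse (2 ^ M + j) = 1 ∧ thueMorse j = 0) with ⟨b1, b2⟩ | ⟨b1, b2⟩ <;>
        rw [b1, b2] <;> norm_num
    have hupper : ∑ j ∈ range (2 ^ M), (1 - 2 * (thueMorse (2 ^ M + j) : ℝ)) * x ^ (2 ^ M + j) =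
        -x ^ 2 ^ M * ∑ j ∈ range (2 ^ M), (1 - 2 * (thueMorse j : ℝ)) * x ^ j := by
      rw [mul_sum]
      refine sum_congr rfl fun j hj => ?_
      rw [hcompl j (mem_range.1 hj), pow_add]
      ring
    rw [pow_succ, mul_two, sum_range_add, hupper]
    have : x ^ 2 ^ M < 1 := pow_lt_one₀ hx0 hx1 (by positivity)
    nlinarith

theorem thueMorse_tail_notMem {β : ℝ} (hβ : IsPisotOrSalem β) :
    digitTail thueMorse β⁻¹ 0 ∉ IntermediateField.adjoin ℚ ({β} : Set ℝ) := by
  intro hmem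
  have hβ0 : 0 < β := by linarith [hβ.1]
  have hx0 : 0 < β⁻¹ := by positivity
  have hx1 : β⁻¹ < 1 := inv_lt_one_of_one_lt₀ hβ.1
  have hs := thueMorse_le_one
  obtain ⟨M₀, hM₀⟩ := hβ.exists_forall_digitTail_eq hs hmem 5
  obtain ⟨M, hM, hM1⟩ : ∃ M, M₀ ≤ M ∧ 1 ≤ M := ⟨M₀ + 1, by omega, by omega⟩
  have hblock (a : ℕ) {j : ℕ} (hj : j < 2 ^ M) :
      tmParity (2 ^ M * a + j) = tmParity j + tmParity a := by
    rw [add_comm, tmParity_add_two_pow_mul hj]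
  have hsize {a : ℕ} (ha : a ≤ 16) : 2 ^ M * a ≤ 2 ^ (5 * M) := by
    calc 2 ^ M * a ≤ 2 ^ M * 2 ^ (4 * M) := by
          gcongr
          exact ha.trans (Nat.pow_le_pow_right two_pos (by omega : 4 ≤ 4 * M))
      _ = _ := by rw [← pow_add]; congr 1; ring
  have hagree {a a' : ℕ} (h : thueMorse a = thueMorse a') (j : ℕ) (hj : j < 2 ^ M) :
      thueMorse (2 ^ M * a + j) = thueMorse (2 ^ M * a' + j) := by
    rw [thueMorse_eq_iff, hblock _ hj, hblock _ hj, thueMorse_eq_iff.1 h]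
  have h5 : thueMorse 5 = thueMorse 12 := by simp [thueMorse]
  have h7 : thueMorse 7 = thueMorse 14 := by simp [thueMorse]
  have e5 := hM₀ M hM _ _ (hsize (a := 5) (by norm_num)) (hsize (a := 12) (by norm_num))
    (hagree h5)
  have e7 := hM₀ M hM _ _ (hsize (a := 7) (by norm_num)) (hsize (a := 14) (by norm_num))
    (hagree h7)
  have e6 := digitTail_sub_of_agree hs hx0.le hx1 (hagree h5)
  rw [e5, sub_self, eq_comm, mul_eq_zero, or_iff_right (by positivity), sub_eq_zero,
    digitTail_eq_sum_add hs hx0.le hx1 _ (2 ^ M),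
    digitTail_eq_sum_add hs hx0.le hx1 (2 ^ M * 12 + 2 ^ M) (2 ^ M),
    show 2 ^ M * 5 + 2 ^ M + 2 ^ M = 2 ^ M * 7 by ring,
    show 2 ^ M * 12 + 2 ^ M + 2 ^ M = 2 ^ M * 14 by ring, e7, add_left_inj, ← sub_eq_zero,
    ← sum_sub_distrib] at e6
  have hneg : ∑ j ∈ range (2 ^ M), (1 - 2 * (thueMorse j : ℝ)) * β⁻¹ ^ j = 0 := by
    rw [← neg_eq_zero, ← e6, ← sum_neg_distrib]
    refine sum_congr rfl fun j hj => ?_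
    have hj := mem_range.1 hj
    have h6 : thueMorse (2 ^ M * 5 + 2 ^ M + j) = thueMorse j := by
      rw [thueMorse_eq_iff, show 2 ^ M * 5 + 2 ^ M + j = 2 ^ M * 6 + j by ring, hblock _ hj]
      simp [tmParity, thueMorse]
    have h13 : thueMorse (2 ^ M * 12 + 2 ^ M + j) ≠ thueMorse j := by
      rw [Ne, thueMorse_eq_iff, show 2 ^ M * 12 + 2 ^ M + j = 2 ^ M * 13 + j by ring, hblock _ hj]
      simp [tmParity, thueMorse]
    have b1 := hs j
    have b2 := hs (2 ^ M * 12 + 2 ^ M + j)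
    rw [h6]
    rcases (by omega : thueMorse (2 ^ M * 12 + 2 ^ M + j) = 0 ∧ thueMorse j = 1 ∨
      thueMorse (2 ^ M * 12 + 2 ^ M + j) = 1 ∧ thueMorse j = 0) with ⟨b1, b2⟩ | ⟨b1, b2⟩ <;>
      rw [b1, b2] <;> norm_num
  exact (sum_thueMorse_sign_pos hx0.le hx1 M).ne' hneg

theorem tmParity_mul_two_pow_add_pow {m v w k' a j r o : ℕ} (hk : m + 2 = 2 ^ v * k')
    (hj : j ^ (m + 2) = r + 2 ^ (2 * v + w) * o) (hr : r < 2 ^ (2 * v + w))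
    (hX : k' * a * j ^ (m + 1) + o < 2 ^ w)
    (hc : ∀ i < m + 1, (m + 2).choose (i + 2) * a ^ (i + 2) * j ^ (m - i) < 2 ^ (v + w)) :
    tmParity ((a * 2 ^ (v + w) + j) ^ (m + 2)) =
      tmParity r + (tmParity (k' * a * j ^ (m + 1) + o) +
        ∑ i ∈ range (m + 1), tmParity ((m + 2).choose (i + 2) * a ^ (i + 2) * j ^ (m - i))) := by
  rw [← tmParity_sum_two_pow_mul _ _ hc, ← tmParity_add_two_pow_mul hX,
    ← tmParity_add_two_pow_mul hr]
  congr 1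
  rw [add_pow, sum_range_succ', sum_range_succ']
  simp only [Nat.choose_zero_right, zero_add, Nat.choose_one_right, pow_zero, pow_one, Nat.sub_zero,
    one_mul, mul_one, Nat.cast_id, hj]
  rw [show m + 2 - 1 = m + 1 by omega]
  have hsum : ∑ i ∈ range (m + 1), (a * 2 ^ (v + w)) ^ (i + 1 + 1) * j ^ (m + 2 - (i + 1 + 1)) *
      (m + 2).choose (i + 1 + 1) = 2 ^ (2 * v + w) * 2 ^ w * ∑ i ∈ range (m + 1),
        2 ^ ((v + w) * i) * ((m + 2).choose (i + 2) * a ^ (i + 2) * j ^ (m - i)) := by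
    rw [mul_sum]
    refine sum_congr rfl fun i hi => ?_
    rw [show m + 2 - (i + 1 + 1) = m - i by omega, mul_pow, ← pow_mul,
      show (v + w) * (i + 1 + 1) = (2 * v + w) + w + (v + w) * i by ring, pow_add, pow_add]
    ring
  rw [hsum, hk]
  ring

theorem exists_mul_add_one_eq_two_pow_mul_odd {c : ℕ} (hc : Odd c) (n : ℕ) :
    ∃ a y, c * a + 1 = 2 ^ n * (2 * y + 1) := by
  have hcop : c.Coprime (2 ^ (n + 1)) := (Nat.coprime_two_right.2 hc).pow_right _
  obtain ⟨a, -, ha⟩ := Nat.exists_mul_mod_eq_of_coprime (2 ^ n - 1) hcop (by positivity)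
  have hp := Nat.one_le_two_pow (n := n)
  rw [Nat.mod_eq_of_lt (by rw [pow_succ]; omega : 2 ^ n - 1 < 2 ^ (n + 1))] at ha
  refine ⟨a, c * a / 2 ^ (n + 1), ?_⟩
  have h := Nat.mod_add_div (c * a) (2 ^ (n + 1))
  rw [ha] at h
  nth_rw 1 [← h]
  rw [pow_succ, mul_add, mul_one, ← mul_assoc]
  omega

theorem exists_odd_even_trailing_ones {p k' : ℕ} (hp : 1 ≤ p) (hk' : Odd k') :
    ∃ a e f y z : ℕ, Odd e ∧ Even f ∧ k' * a * 1 ^ p + 1 = 2 ^ e * (2 * y + 1) ∧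
      k' * a * 3 ^ p + 1 = 2 ^ f * (2 * z + 1) := by
  have h3 : 3 ^ p - 1 ≠ 0 := by
    have := Nat.pow_le_pow_right (n := 3) (by norm_num) hp
    omega
  obtain ⟨h, q, hq, hpq⟩ := Nat.exists_eq_two_pow_mul_odd h3
  have hpq : 3 ^ p = 1 + 2 ^ h * q := by omega
  rcases Nat.even_or_odd h with hh | hh
  · obtain ⟨a, y, hay⟩ := exists_mul_add_one_eq_two_pow_mul_odd hk' (h + 1)
    have hodd : Odd (k' * a) := by
      have h2 : Even (k' * a + 1) := by
        rw [hay, pow_succ, mul_assoc]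
        exact (even_two_mul _).mul_left _
      rwa [Nat.even_add_one, Nat.not_even_iff_odd] at h2
    obtain ⟨z, hz⟩ := hodd.mul hq
    refine ⟨a, h + 1, h, y, 2 * y + 1 + z, hh.add_one, hh, by rwa [one_pow, mul_one], ?_⟩
    rw [hpq]
    linear_combination hay + 2 ^ h * hz
  · obtain ⟨a, z, haz⟩ := exists_mul_add_one_eq_two_pow_mul_odd
      (hk'.mul ((by decide : Odd 3).pow (n := p))) (h + 1)
    have haz' : k' * a * 3 ^ p + 1 = 2 ^ (h + 1) * (2 * z + 1) := by rw [← haz]; ring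
    have hodd : Odd (k' * a) := by
      have h2 : Even (k' * a * 3 ^ p + 1) := by
        rw [haz', pow_succ, mul_assoc]
        exact (even_two_mul _).mul_left _
      rw [Nat.even_add_one, Nat.not_even_iff_odd] at h2
      exact (Nat.odd_mul.1 h2).1
    have hsum : k' * a + 1 + 2 ^ h * (k' * a * q) = 2 ^ h * (2 * (2 * z + 1)) := by
      rw [hpq] at haz'
      linear_combination haz'
    obtain ⟨C, hC⟩ : 2 ^ h ∣ k' * a + 1 :=
      (Nat.dvd_add_left (Dvd.intro _ rfl)).1 (hsum ▸ Dvd.intro _ rfl)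
    obtain ⟨r, hr⟩ := hodd.mul hq
    rw [hC, ← mul_add, Nat.mul_right_inj (by positivity), hr] at hsum
    refine ⟨a, h, h + 1, C / 2, z, hh, hh.add_one, ?_, haz'⟩
    rw [one_pow, mul_one, hC]
    congr 1
    omega

theorem eq_two_pow_mul_odd_of_modEq {z z' e y : ℕ} (hz : z = 2 ^ e * (2 * y + 1))
    (h : z' ≡ z [MOD 2 ^ (e + 1)]) : ∃ y', z' = 2 ^ e * (2 * y' + 1) := by
  have h1 : z' % 2 ^ (e + 1) = 2 ^ e := by
    rw [h, hz, mul_add, mul_one, ← mul_assoc, ← pow_succ, Nat.mul_add_mod,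
      Nat.mod_eq_of_lt (Nat.pow_lt_pow_right one_lt_two (by omega))]
  refine ⟨z' / 2 ^ (e + 1), ?_⟩
  have := Nat.mod_add_div z' (2 ^ (e + 1))
  rw [h1, pow_succ] at this
  rw [pow_succ]
  linarith

theorem add_pow_succ_le_add_three_pow_mul {x y : ℕ} (h : y ≤ x) (n : ℕ) :
    (x + y) ^ (n + 1) ≤ x ^ (n + 1) + 3 ^ (n + 1) * y * x ^ n := by
  induction n with
  | zero => simp; omega
  | succ n ih =>
    calc (x + y) ^ (n + 2) = (x + y) ^ (n + 1) * (x + y) := pow_succ _ _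
      _ ≤ (x ^ (n + 1) + 3 ^ (n + 1) * y * x ^ n) * (x + y) := Nat.mul_le_mul_right _ ih
      _ = x ^ (n + 2) + (y * x ^ (n + 1) + 3 ^ (n + 1) * y * x ^ (n + 1)) +
            3 ^ (n + 1) * y * x ^ n * y := by ring
      _ ≤ x ^ (n + 2) + (3 ^ (n + 1) * (y * x ^ (n + 1)) + 3 ^ (n + 1) * y * x ^ (n + 1)) +
            3 ^ (n + 1) * y * x ^ n * x := by
          have := Nat.le_mul_of_pos_left (y * x ^ (n + 1)) (pow_pos three_pos (n + 1))
          gcongr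
      _ = x ^ (n + 1 + 1) + 3 ^ (n + 1 + 1) * y * x ^ (n + 1) := by ring

theorem exists_forall_coeff_lt (m k' a : ℕ) : ∃ E : ℕ, ∀ M j : ℕ, j < 2 ^ (M + 1) →
    k' * a * j ^ (m + 1) + 1 < 2 ^ (E + (m + 1) * M) ∧ ∀ i < m + 1,
      (m + 2).choose (i + 2) * a ^ (i + 2) * j ^ (m - i) < 2 ^ (E + (m + 1) * M) := by
  refine ⟨(k' * a + 1) * 2 ^ (m + 1) + 2 ^ (m + 2) * (a + 1) ^ (m + 2) * 2 ^ (m + 1),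
    fun M j hj => ?_⟩
  set E := (k' * a + 1) * 2 ^ (m + 1) + 2 ^ (m + 2) * (a + 1) ^ (m + 2) * 2 ^ (m + 1) with hE
  have hlt : E * 2 ^ ((m + 1) * M) < 2 ^ (E + (m + 1) * M) := by
    rw [pow_add]
    exact Nat.mul_lt_mul_of_pos_right Nat.lt_two_pow_self (by positivity)
  have hpow : (2 ^ (M + 1)) ^ (m + 1) = 2 ^ (m + 1) * 2 ^ ((m + 1) * M) := by
    rw [← pow_mul, ← pow_add]; congr 1; ring
  refine ⟨lt_of_le_of_lt ?_ hlt, fun i hi => lt_of_le_of_lt ?_ hlt⟩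
  · calc k' * a * j ^ (m + 1) + 1
        ≤ k' * a * (2 ^ (M + 1)) ^ (m + 1) + (2 ^ (M + 1)) ^ (m + 1) := by
          gcongr
          exact Nat.one_le_pow _ _ (by positivity)
      _ = (k' * a + 1) * 2 ^ (m + 1) * 2 ^ ((m + 1) * M) := by rw [hpow]; ring
      _ ≤ _ := Nat.mul_le_mul_right _ (Nat.le_add_right _ _)
  · calc (m + 2).choose (i + 2) * a ^ (i + 2) * j ^ (m - i)
        ≤ 2 ^ (m + 2) * (a + 1) ^ (m + 2) * (2 ^ (M + 1)) ^ (m + 1) := by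
          refine Nat.mul_le_mul (Nat.mul_le_mul (Nat.choose_le_two_pow _ _) ?_) ?_
          · exact (Nat.pow_le_pow_left (Nat.le_succ a) _).trans
              (Nat.pow_le_pow_right (Nat.succ_pos a) (by omega))
          · exact (Nat.pow_le_pow_left hj.le _).trans
              (Nat.pow_le_pow_right (by positivity) (by omega))
      _ = 2 ^ (m + 2) * (a + 1) ^ (m + 2) * 2 ^ (m + 1) * 2 ^ ((m + 1) * M) := by
          rw [hpow]; ring
      _ ≤ _ := Nat.mul_le_mul_right _ (Nat.le_add_left _ _)

/-- Two translates of `n ↦ t(nᵏ)` that agree on a block of length `2 ^ M` and then differ in a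
controlled way: at index `1` but neither at index `3` nor at small even indices. -/
theorem exists_translates_thueMorse_pow {k : ℕ} (hk : 2 ≤ k) : ∃ c : ℕ, ∀ J : ℕ, ∃ M₁ : ℕ,
    ∀ M ≥ M₁, ∃ A A' : ℕ, A ≤ 2 ^ (c * M) ∧ A' ≤ 2 ^ (c * M) ∧
      (∀ j < 2 ^ M, thueMorse ((A + j) ^ k) = thueMorse ((A' + j) ^ k)) ∧
      thueMorse ((A + 2 ^ M + 1) ^ k) ≠ thueMorse ((A' + 2 ^ M + 1) ^ k) ∧
      thueMorse ((A + 2 ^ M + 3) ^ k) = thueMorse ((A' + 2 ^ M + 3) ^ k) ∧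
      ∀ i < J, thueMorse ((A + 2 ^ M + 2 * i) ^ k) = thueMorse ((A' + 2 ^ M + 2 * i) ^ k) := by
  obtain ⟨m, rfl⟩ : ∃ m, k = m + 2 := ⟨k - 2, by omega⟩
  obtain ⟨v, k', hk', hkv⟩ := Nat.exists_eq_two_pow_mul_odd (n := m + 2) (by omega)
  obtain ⟨a, e, f, y, z, he, hf, hy, hz⟩ :=
    exists_odd_even_trailing_ones (p := m + 1) (by omega) hk'
  obtain ⟨E, hE⟩ := exists_forall_coeff_lt m k' a
  refine ⟨2 * (m + 2) + 1, fun J => ⟨E + 2 * v + a + e + f + 3 ^ (m + 2) * (2 * J + 4) + 2,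
    fun M hM => ?_⟩⟩
  set n := m + 2 with hn
  obtain ⟨w, hw⟩ : ∃ w, n * M = 2 * v + w := by
    refine ⟨n * M - 2 * v, ?_⟩
    have : M ≤ n * M := Nat.le_mul_of_pos_left _ (by omega)
    omega
  have hEw : E + (m + 1) * M ≤ w := by
    have : n * M = (m + 1) * M + M := by rw [hn]; ring
    omega
  obtain ⟨w', hw'⟩ : ∃ w', 2 * (n * M) = v + w' := ⟨2 * (n * M) - v, by omega⟩
  have hww' : w ≤ w' := by omega
  have haM : a ≤ 2 ^ M := Nat.lt_two_pow_self.le.trans (Nat.pow_le_pow_right two_pos (by omega))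
  have hsize {K : ℕ} (hK : K ≤ 2 * (n * M)) : a * 2 ^ K ≤ 2 ^ ((2 * n + 1) * M) :=
    calc a * 2 ^ K ≤ 2 ^ M * 2 ^ (2 * (n * M)) :=
          Nat.mul_le_mul haM (Nat.pow_le_pow_right two_pos hK)
      _ = _ := by rw [← pow_add]; congr 1; ring
  let T : ℕ → ZMod 2 := fun j =>
    ∑ i ∈ range (m + 1), tmParity (n.choose (i + 2) * a ^ (i + 2) * j ^ (m - i))
  have hM2 : 2 ^ (M + 1) = 2 * 2 ^ M := by rw [pow_succ]; ring
  have hdigits {j r o u : ℕ} (hu : w ≤ u) (hj : j < 2 ^ (M + 1)) (ho : o ≤ 1)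
      (hjr : j ^ n = r + 2 ^ (2 * v + u) * o) (hr : r < 2 ^ (2 * v + u)) :
      tmParity ((a * 2 ^ (v + u) + j) ^ n) =
        tmParity r + (tmParity (k' * a * j ^ (m + 1) + o) + T j) := by
    obtain ⟨h1, h2⟩ := hE M j hj
    have h3 : 2 ^ (E + (m + 1) * M) ≤ 2 ^ u := Nat.pow_le_pow_right two_pos (by omega)
    have h4 : 2 ^ u ≤ 2 ^ (v + u) := Nat.pow_le_pow_right two_pos (by omega)
    exact tmParity_mul_two_pow_add_pow hkv hjr hr (by omega)
      fun i hi => (h2 i hi).trans_le (h3.trans h4)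
  have hfar {j : ℕ} (hj : j < 2 ^ (M + 1)) : tmParity ((a * 2 ^ (v + w') + j) ^ n) =
      tmParity (j ^ n) + (tmParity (k' * a * j ^ (m + 1)) + T j) := by
    refine hdigits (o := 0) hww' hj zero_le_one (by ring) ?_
    calc j ^ n < (2 ^ (M + 1)) ^ n := Nat.pow_lt_pow_left hj (by omega)
      _ = 2 ^ (n * M + n) := by rw [← pow_mul]; congr 1; ring
      _ ≤ _ := by
        refine Nat.pow_le_pow_right two_pos ?_
        have : n * 1 ≤ n * M := Nat.mul_le_mul_left _ (by omega)
        omega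
  have hblock (j : ℕ) (hj : j < 2 ^ M) : thueMorse ((a * 2 ^ (v + w) + j) ^ n) =
      thueMorse ((a * 2 ^ (v + w') + j) ^ n) := by
    rw [thueMorse_eq_iff, hfar (by omega)]
    refine hdigits (o := 0) le_rfl (by omega) zero_le_one (by ring) ?_
    rw [← hw, mul_comm, pow_mul]
    exact Nat.pow_lt_pow_left hj (by omega)
  have hcarry {i g q : ℕ} (hi : i < 2 * J + 4)
      (hg : k' * a * (2 ^ M + i) ^ (m + 1) + 1 = 2 ^ g * (2 * q + 1)) :
      thueMorse ((a * 2 ^ (v + w) + 2 ^ M + i) ^ n) =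
        thueMorse ((a * 2 ^ (v + w') + 2 ^ M + i) ^ n) ↔ (g : ZMod 2) = 0 := by
    have hsmall : 3 ^ n * i < 2 ^ M := by
      calc 3 ^ n * i ≤ 3 ^ n * (2 * J + 4) := Nat.mul_le_mul_left _ hi.le
        _ < 2 ^ (3 ^ n * (2 * J + 4)) := Nat.lt_two_pow_self
        _ ≤ 2 ^ M := Nat.pow_le_pow_right two_pos (by omega)
    have hiM : i < 2 ^ M := lt_of_le_of_lt (Nat.le_mul_of_pos_left _ (by positivity)) hsmall
    have hpow : (2 ^ M) ^ n = 2 ^ (2 * v + w) := by rw [← hw, mul_comm n, pow_mul]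
    have hlo : 2 ^ (2 * v + w) ≤ (2 ^ M + i) ^ n := by
      rw [← hpow]; exact Nat.pow_le_pow_left (Nat.le_add_right _ _) _
    have hhi : (2 ^ M + i) ^ n < 2 ^ (2 * v + w) + 2 ^ (2 * v + w) := by
      refine (add_pow_succ_le_add_three_pow_mul hiM.le (m + 1)).trans_lt ?_
      rw [← hpow]
      refine Nat.add_lt_add_left ?_ _
      calc 3 ^ (m + 1 + 1) * i * (2 ^ M) ^ (m + 1) < 2 ^ M * (2 ^ M) ^ (m + 1) :=
            Nat.mul_lt_mul_of_pos_right hsmall (by positivity)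
        _ = (2 ^ M) ^ n := by rw [hn]; ring
    obtain ⟨r, hr⟩ := Nat.exists_eq_add_of_le' hlo
    have hr' : r < 2 ^ (2 * v + w) := by omega
    have hj : 2 ^ M + i < 2 ^ (M + 1) := by omega
    have htop := tmParity_add_two_pow_mul hr' 1
    rw [mul_one, ← hr, tmParity_one] at htop
    rw [thueMorse_eq_iff, add_assoc, add_assoc, hfar hj,
      hdigits le_rfl hj le_rfl (by rw [hr, mul_one]) hr', tmParity_succ_of_eq hg, htop]
    constructor
    · intro h
      linear_combination h
    · intro h
      linear_combination h
  have hmod {i g q : ℕ} (hgM : g + 1 ≤ M) (hg : k' * a * i ^ (m + 1) + 1 = 2 ^ g * (2 * q + 1)) :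
      ∃ q', k' * a * (2 ^ M + i) ^ (m + 1) + 1 = 2 ^ g * (2 * q' + 1) := by
    refine eq_two_pow_mul_odd_of_modEq hg (Nat.ModEq.add_right _ (Nat.ModEq.mul_left _ ?_))
    refine Nat.ModEq.pow _ ?_
    have := (Nat.modEq_zero_iff_dvd.2 (pow_dvd_pow 2 hgM)).add_right i
    rwa [zero_add] at this
  refine ⟨a * 2 ^ (v + w), a * 2 ^ (v + w'), hsize (by omega), hsize (by omega), hblock,
    ?_, ?_, fun i hi => ?_⟩
  · obtain ⟨q, hq⟩ := hmod (by omega) hy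
    rw [Ne, hcarry (by omega) hq, ZMod.natCast_eq_zero_iff_even]
    exact Nat.not_even_iff_odd.2 he
  · obtain ⟨q, hq⟩ := hmod (by omega) hz
    rwa [hcarry (by omega) hq, ZMod.natCast_eq_zero_iff_even]
  · have heven : Even (k' * a * (2 ^ M + 2 * i) ^ (m + 1)) := by
      refine Even.mul_left (Even.pow_of_ne_zero ?_ (by omega)) _
      exact (even_two.pow_of_ne_zero (by omega)).add (even_two_mul i)
    obtain ⟨q, hq⟩ := heven
    rw [hcarry (g := 0) (q := q) (by omega) (by rw [hq]; ring)]
    simp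

theorem gamma_k_not_in_Q_beta
    (β : ℝ) (hβ : IsPisotOrSalem β) (hgt : Real.sqrt Real.goldenRatio < β)
    (k : ℕ) (hk : 1 ≤ k) :
    (∑' n : ℕ, (thueMorse ((n + 1) ^ k) : ℝ) / β ^ (n + 1)) ∉
      IntermediateField.adjoin ℚ ({β} : Set ℝ) := by
  have hβ0 : 0 < β := by linarith [hβ.1]
  have hx0 : 0 < β⁻¹ := by positivity
  have hx1 : β⁻¹ < 1 := inv_lt_one_of_one_lt₀ hβ.1
  have hs (n : ℕ) : thueMorse (n ^ k) ≤ 1 := thueMorse_le_one _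
  have hγ : ∑' n : ℕ, (thueMorse ((n + 1) ^ k) : ℝ) / β ^ (n + 1) =
      digitTail (fun n => thueMorse (n ^ k)) β⁻¹ 0 := by
    have h0 : thueMorse (0 ^ k) = 0 := by simp [thueMorse, Nat.ne_of_gt hk]
    rw [digitTail, (summable_digitTail hs hx0.le hx1 0).tsum_eq_zero_add]
    simp [h0, div_eq_mul_inv]
  rw [hγ]
  rcases hk.eq_or_lt with rfl | hk2
  · simpa only [pow_one] using thueMorse_tail_notMem hβ
  intro hmem
  have hx : β⁻¹ ^ 2 + β⁻¹ ^ 4 < 1 := by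
    have h1 : Real.goldenRatio < β ^ 2 := (Real.sqrt_lt' hβ0).1 hgt
    have h2 : β ^ 2 + 1 < β ^ 4 := by
      nlinarith [Real.goldenRatio_sq, Real.one_lt_goldenRatio]
    have h3 : β⁻¹ ^ 2 + β⁻¹ ^ 4 = (β ^ 2 + 1) / β ^ 4 := by field_simp
    rw [h3, div_lt_one (by positivity)]
    exact h2
  obtain ⟨c, hc⟩ := exists_translates_thueMorse_pow hk2
  obtain ⟨J, hJ⟩ := exists_forall_digitTail_ne hs hx0 hx
  obtain ⟨M₁, hM₁⟩ := hc J
  obtain ⟨M₀, hM₀⟩ := hβ.exists_forall_digitTail_eq hs hmem c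
  obtain ⟨A, A', hA, hA', hagree, h1, h3, heven⟩ := hM₁ (max M₀ M₁) (le_max_right _ _)
  have heq := digitTail_sub_of_agree hs hx0.le hx1 hagree
  rw [hM₀ _ (le_max_left _ _) A A' hA hA' hagree, sub_self, eq_comm, mul_eq_zero,
    or_iff_right (by positivity), sub_eq_zero] at heq
  exact hJ _ _ h1 h3 heven heq
end

section
/- Let β be a Pisot or Salem number with β > √φ, where φ = (1+√5)/2 is the golden ratio. Let k ≥ 1 and let a₁, a₂, …, a_k ∈ ℚ(β), not all zero. Then the sequence s(n) := a₁·t(n) + a₂·t(n²) + ⋯ + a_k·t(n^k) (n ≥ 1) is not eventually periodic; that is, there do not exist integers p ≥ 1 and n₀ ≥ 1 such that s(n + p) = s(n) for all n ≥ n₀. -/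
open Polynomial Filter

theorem thueMorse_two_mul (n : ℕ) : thueMorse (2 * n) = thueMorse n := by
  rcases Nat.eq_zero_or_pos n with rfl | hn
  · rfl
  · simp [thueMorse, Nat.digits_def' (b := 2) (n := 2 * n) (by norm_num) (by omega)]

theorem thueMorse_two_mul_add_one (n : ℕ) :
    thueMorse (2 * n + 1) = (thueMorse n + 1) % 2 := by
  have h : (2 * n + 1) / 2 = n := by omega
  have h' : (2 * n + 1) % 2 = 1 := by omega
  rw [thueMorse, Nat.digits_def' (b := 2) (n := 2 * n + 1) (by norm_num) (by omega), h, h',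
    List.sum_cons, thueMorse]
  omega

theorem thueMorse_lt_two (n : ℕ) : thueMorse n < 2 := Nat.mod_lt _ (by norm_num)

/-- Digit sums are additive over disjoint blocks of binary digits. -/
theorem thueMorse_add_two_pow_mul (A : ℕ) :
    ∀ a b : ℕ, a < 2 ^ A → thueMorse (a + 2 ^ A * b) = (thueMorse a + thueMorse b) % 2 := by
  induction A with
  | zero =>
    intro a b ha
    obtain rfl : a = 0 := by simpa using ha
    have h0 : thueMorse 0 = 0 := rfl
    have := thueMorse_lt_two b
    simp only [h0, pow_zero, one_mul, zero_add]
    omega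
  | succ A ih =>
    intro a b ha
    rw [pow_succ] at ha
    rcases Nat.even_or_odd' a with ⟨c, rfl | rfl⟩
    · rw [show 2 * c + 2 ^ (A + 1) * b = 2 * (c + 2 ^ A * b) by ring, thueMorse_two_mul,
        thueMorse_two_mul, ih c b (by omega)]
    · rw [show 2 * c + 1 + 2 ^ (A + 1) * b = 2 * (c + 2 ^ A * b) + 1 by ring,
        thueMorse_two_mul_add_one, thueMorse_two_mul_add_one, ih c b (by omega)]
      omega

/-- Complementing a block of `A` binary digits. -/
theorem thueMorse_complement (A : ℕ) :
    ∀ c d : ℕ, c + d + 1 = 2 ^ A → thueMorse d = (thueMorse c + A) % 2 := by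
  induction A with
  | zero =>
    intro c d h
    obtain ⟨rfl, rfl⟩ : c = 0 ∧ d = 0 := by simp at h; exact h
    rfl
  | succ A ih =>
    intro c d h
    rw [pow_succ] at h
    rcases Nat.even_or_odd' c with ⟨c', rfl | rfl⟩
    · obtain ⟨d', rfl⟩ : ∃ d', d = 2 * d' + 1 := ⟨d / 2, by omega⟩
      rw [thueMorse_two_mul, thueMorse_two_mul_add_one, ih c' d' (by omega)]
      omega
    · obtain ⟨d', rfl⟩ : ∃ d', d = 2 * d' := ⟨d / 2, by omega⟩
      rw [thueMorse_two_mul, thueMorse_two_mul_add_one, ih c' d' (by omega)]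
      omega

theorem eventually_lt_two_pow (c : ℕ) : ∀ᶠ A : ℕ in atTop, c < 2 ^ A := by
  filter_upwards [eventually_ge_atTop c] with A hA
  exact hA.trans_lt Nat.lt_two_pow_self

/-- The Thue–Morse value of a natural-coefficient polynomial at `2 ^ A` stabilizes. -/
theorem exists_eventually_thueMorse_eval_eq (G : ℕ[X]) :
    ∃ τ, ∀ᶠ A : ℕ in atTop, thueMorse (G.eval (2 ^ A)) = τ := by
  induction hd : G.natDegree generalizing G with
  | zero =>
    rw [natDegree_eq_zero] at hd
    obtain ⟨c, rfl⟩ := hd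
    exact ⟨thueMorse c, by simp⟩
  | succ d ih =>
    obtain ⟨τ, hτ⟩ := ih G.divX (by rw [natDegree_divX_eq_natDegree_tsub_one, hd]; rfl)
    refine ⟨(thueMorse (G.coeff 0) + τ) % 2, ?_⟩
    filter_upwards [hτ, eventually_lt_two_pow (G.coeff 0)] with A hA hlt
    rw [← hA, ← thueMorse_add_two_pow_mul A _ _ hlt]
    conv_lhs => rw [← divX_mul_X_add G]
    simp only [eval_add, eval_mul, eval_X, eval_C]
    ring_nf

theorem exists_natCast_map_eq (f : ℤ[X]) (hf : ∀ m, 0 ≤ f.coeff m) :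
    ∃ G : ℕ[X], G.map (Nat.castRingHom ℤ) = f := by
  have : f ∈ lifts (Nat.castRingHom ℤ) := by
    rw [lifts_iff_coeff_lifts]
    intro m
    exact ⟨(f.coeff m).toNat, by simp [hf m]⟩
  exact (mem_lifts f).1 this

theorem eval_two_pow_map (G : ℕ[X]) (A : ℕ) :
    (G.map (Nat.castRingHom ℤ)).eval (2 ^ A) = ((G.eval (2 ^ A) : ℕ) : ℤ) := by
  have := eval_natCast_map (Nat.castRingHom ℤ) G (2 ^ A)
  simpa using this

theorem eventually_thueMorse_eval_succ_eq (f : ℤ[X]) (hf : ∀ m, 0 ≤ f.coeff m) :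
    ∀ᶠ A : ℕ in atTop, ∀ n n' : ℕ, (n : ℤ) = f.eval (2 ^ A) → (n' : ℤ) = f.eval (2 ^ (A + 1)) →
      thueMorse n' = thueMorse n := by
  obtain ⟨G, rfl⟩ := exists_natCast_map_eq f hf
  obtain ⟨τ, hτ⟩ := exists_eventually_thueMorse_eval_eq G
  filter_upwards [hτ, (tendsto_add_atTop_nat 1).eventually hτ] with A h1 h2 n n' hn hn'
  rw [eval_two_pow_map, Nat.cast_inj] at hn hn'
  rw [hn, hn', h1, h2]

/-- A single negative coefficient produces a block of ones whose length grows with `A`,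
so the Thue–Morse value at `2 ^ A` alternates. -/
theorem eventually_thueMorse_eval_succ_ne (f : ℤ[X]) (hf : ∀ m, m ≠ 2 → 0 ≤ f.coeff m)
    (h2 : f.coeff 2 < 0) (h3 : 0 < f.coeff 3) :
    ∀ᶠ A : ℕ in atTop, ∀ n n' : ℕ, (n : ℤ) = f.eval (2 ^ A) → (n' : ℤ) = f.eval (2 ^ (A + 1)) →
      thueMorse n' ≠ thueMorse n := by
  obtain ⟨G, hG⟩ := exists_natCast_map_eq (f.divX.divX.divX - 1) (by
    intro m
    rcases m with _ | m
    · simp only [coeff_sub, coeff_divX, coeff_one]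
      norm_num
      omega
    · have := hf (m + 1 + 1 + 1 + 1) (by omega)
      simpa [coeff_divX, coeff_one] using this)
  obtain ⟨a, ha⟩ := Int.eq_ofNat_of_zero_le (hf 0 (by norm_num))
  obtain ⟨b, hb⟩ := Int.eq_ofNat_of_zero_le (hf 1 (by norm_num))
  obtain ⟨c, hc⟩ : ∃ c : ℕ, f.coeff 2 = -(c + 1 : ℤ) := ⟨(-f.coeff 2 - 1).toNat, by omega⟩
  have hfe : ∀ x : ℤ, f.eval x =
      a + x * (b + x * (x - 1 - c + x * (G.map (Nat.castRingHom ℤ)).eval x)) := by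
    intro x
    have e0 := congrArg (eval x) (divX_mul_X_add f)
    have e1 := congrArg (eval x) (divX_mul_X_add f.divX)
    have e2 := congrArg (eval x) (divX_mul_X_add f.divX.divX)
    simp only [eval_add, eval_mul, eval_X, eval_C, coeff_divX, zero_add, Nat.reduceAdd] at e0 e1 e2
    rw [hG, ← e0, ← e1, ← e2, ha, hb, hc]
    simp only [eval_sub, eval_one]
    ring
  obtain ⟨τ, hτ⟩ := exists_eventually_thueMorse_eval_eq G
  have key : ∀ᶠ A : ℕ in atTop, ∀ n : ℕ, (n : ℤ) = f.eval (2 ^ A) →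
      thueMorse n = (thueMorse a + thueMorse b + thueMorse c + τ + A) % 2 := by
    filter_upwards [hτ, eventually_lt_two_pow a, eventually_lt_two_pow b,
      eventually_lt_two_pow c] with A hA hla hlb hlc n hn
    obtain ⟨d, hd⟩ : ∃ d, c + d + 1 = 2 ^ A := ⟨2 ^ A - 1 - c, by omega⟩
    have hdz : (2 : ℤ) ^ A - 1 - c = d := by
      have : ((c + d + 1 : ℕ) : ℤ) = ((2 ^ A : ℕ) : ℤ) := congrArg _ hd
      push_cast at this
      linarith
    rw [hfe, eval_two_pow_map, hdz] at hn
    have hn' : n = a + 2 ^ A * (b + 2 ^ A * (d + 2 ^ A * G.eval (2 ^ A))) := by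
      exact_mod_cast hn
    rw [hn', thueMorse_add_two_pow_mul A _ _ hla, thueMorse_add_two_pow_mul A _ _ hlb,
      thueMorse_add_two_pow_mul A _ _ (by omega), hA, thueMorse_complement A c d hd]
    omega
  filter_upwards [key, (tendsto_add_atTop_nat 1).eventually key] with A h1 h2 n n' hn hn'
  rw [h1 n hn, h2 n' hn']
  omega

/-- All coefficients are nonnegative, and those of degree at most `d` are positive. -/
def PosCoeffUpTo (d : ℕ) (f : ℤ[X]) : Prop :=
  (∀ n, 0 ≤ f.coeff n) ∧ ∀ n ≤ d, 0 < f.coeff n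

theorem coeff_mul_nonneg {f g : ℤ[X]} (hf : ∀ n, 0 ≤ f.coeff n) (hg : ∀ n, 0 ≤ g.coeff n)
    (n : ℕ) : 0 ≤ (f * g).coeff n := by
  rw [coeff_mul]
  exact Finset.sum_nonneg fun x _ => mul_nonneg (hf _) (hg _)

theorem PosCoeffUpTo.mul {d e : ℕ} {f g : ℤ[X]} (hf : PosCoeffUpTo d f) (hg : PosCoeffUpTo e g) :
    PosCoeffUpTo (d + e) (f * g) := by
  refine ⟨coeff_mul_nonneg hf.1 hg.1, fun n hn => ?_⟩
  rw [coeff_mul]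
  refine Finset.sum_pos' (fun x _ => mul_nonneg (hf.1 _) (hg.1 _))
    ⟨(min n d, n - min n d), by simp, mul_pos (hf.2 _ (by simp)) (hg.2 _ (by simp; omega))⟩

theorem PosCoeffUpTo.pow {d : ℕ} {f : ℤ[X]} (hf : PosCoeffUpTo d f) (i : ℕ) :
    PosCoeffUpTo (d * i) (f ^ i) := by
  induction i with
  | zero =>
    refine ⟨fun n => ?_, fun n hn => ?_⟩
    · rw [pow_zero, coeff_one]; split_ifs <;> norm_num
    · obtain rfl : n = 0 := by simpa using hn
      simp
  | succ i ih => rw [pow_succ, Nat.mul_succ]; exact ih.mul hf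

/-- If `S * Q` has positive coefficients, then for large `M` the powers of `Q + M * X ^ 3 * S ^ K`
have positive coefficients from degree `3` up to `3 * i`. -/
theorem eventually_coeff_pow_add (Q S : ℤ[X]) (K i : ℕ) (hi : 1 ≤ i) (hiK : i ≤ K)
    (hQ : Q.natDegree ≤ 3) (hS : PosCoeffUpTo 0 S) (hSQ : PosCoeffUpTo 3 (S * Q)) :
    ∀ᶠ M : ℤ in atTop, ∀ m, 3 ≤ m →
      0 ≤ ((Q + C M * X ^ 3 * S ^ K) ^ i).coeff m ∧
        (m = 3 → 0 < ((Q + C M * X ^ 3 * S ^ K) ^ i).coeff m) := by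
  have hprod : ∀ l, l ≤ K → PosCoeffUpTo (3 * l) (S ^ K * Q ^ l) := by
    intro l hl
    have h := (hSQ.pow l).mul (hS.pow (K - l))
    have e : (S * Q) ^ l * S ^ (K - l) = S ^ K * Q ^ l := by
      rw [mul_pow, mul_right_comm, ← pow_add, Nat.add_sub_cancel' hl]
    rw [e] at h
    simpa using h
  have hbound : ∀ᶠ M : ℤ in atTop, 0 ≤ M ∧ ∀ m ∈ Finset.range (3 * i + 1),
      -(Q ^ i).coeff m < M := by
    refine (eventually_ge_atTop 0).and ?_
    rw [Filter.eventually_all_finset]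
    exact fun m _ => eventually_gt_atTop _
  filter_upwards [hbound] with M hM m hm
  obtain ⟨hM0, hM⟩ := hM
  obtain ⟨j, rfl⟩ : ∃ j, i = j + 1 := ⟨i - 1, by omega⟩
  have hMX : ∀ n, 0 ≤ (C M * X ^ 3 * S ^ K : ℤ[X]).coeff n := by
    refine coeff_mul_nonneg (fun n => ?_) (hS.pow K).1
    rw [coeff_C_mul, coeff_X_pow]
    split_ifs <;> simp [hM0]
  have hMXpow : ∀ l n, 0 ≤ ((C M * X ^ 3 * S ^ K : ℤ[X]) ^ l).coeff n := by
    intro l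
    induction l with
    | zero => intro n; rw [pow_zero, coeff_one]; split_ifs <;> norm_num
    | succ l ih => rw [pow_succ]; exact coeff_mul_nonneg ih hMX
  have hterm : ∀ l ≤ j, ∀ n, 0 ≤ ((C M * X ^ 3 * S ^ K) ^ (l + 1) * Q ^ (j - l)).coeff n := by
    intro l hl
    have e : (C M * X ^ 3 * S ^ K) ^ (l + 1) * Q ^ (j - l) =
        (C M * X ^ 3 * S ^ K) ^ l * (C M * X ^ 3 * (S ^ K * Q ^ (j - l))) := by ring
    rw [e]
    refine coeff_mul_nonneg (hMXpow l) ?_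
    refine coeff_mul_nonneg (fun n => ?_) (hprod (j - l) (by omega)).1
    rw [coeff_C_mul, coeff_X_pow]
    split_ifs <;> simp [hM0]
  have hexp : (Q + C M * X ^ 3 * S ^ K) ^ (j + 1) = Q ^ (j + 1) +
      ∑ l ∈ Finset.range (j + 1), (C M * X ^ 3 * S ^ K) ^ (l + 1) * Q ^ (j - l) *
        ((j + 1).choose (l + 1) : ℤ[X]) := by
    rw [add_comm Q, add_pow, Finset.sum_range_succ', add_comm]
    simp
  have hterm' : ∀ l ≤ j, ∀ n, 0 ≤ ((C M * X ^ 3 * S ^ K) ^ (l + 1) * Q ^ (j - l) *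
        ((j + 1).choose (l + 1) : ℤ[X])).coeff n := by
    intro l hl n
    rw [coeff_mul_natCast]
    exact mul_nonneg (hterm l hl n) (by positivity)
  rw [hexp, coeff_add, finsetSum_coeff]
  by_cases hm' : m ≤ 3 * (j + 1)
  · have h0 : M ≤ ∑ l ∈ Finset.range (j + 1), ((C M * X ^ 3 * S ^ K) ^ (l + 1) * Q ^ (j - l) *
        ((j + 1).choose (l + 1) : ℤ[X])).coeff m := by
      refine le_trans ?_ (Finset.single_le_sum (fun l hl => hterm' l
        (by simpa [Nat.lt_succ_iff] using hl) m) (Finset.mem_range.2 (Nat.succ_pos j)))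
      have e : (C M * X ^ 3 * S ^ K) ^ (0 + 1) * Q ^ (j - 0) =
          C M * ((S ^ K * Q ^ j) * X ^ 3) := by simp; ring
      rw [coeff_mul_natCast, e, coeff_C_mul]
      obtain ⟨m', rfl⟩ : ∃ m', m = m' + 3 := ⟨m - 3, by omega⟩
      rw [coeff_mul_X_pow]
      have hpos := (hprod j (by omega)).2 m' (by omega)
      have hc : (1 : ℤ) ≤ ((j + 1).choose (0 + 1) : ℕ) := by simp
      nlinarith [mul_nonneg hM0 (sub_nonneg.2 hc), mul_nonneg hM0 (sub_nonneg.2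
        (Int.add_one_le_iff.2 hpos)), mul_nonneg (mul_nonneg hM0 hpos.le) (sub_nonneg.2 hc)]
    have h1 := hM m (by simp; omega)
    exact ⟨by linarith, fun _ => by linarith⟩
  · have hz : (Q ^ (j + 1)).coeff m = 0 := by
      refine coeff_eq_zero_of_natDegree_lt ?_
      have := natDegree_pow_le_of_le (j + 1) hQ
      omega
    refine ⟨?_, fun h => by omega⟩
    rw [hz, zero_add]
    exact Finset.sum_nonneg fun l hl => hterm' l (by simpa [Nat.lt_succ_iff] using hl) m

theorem coeff_pow_low (P : ℤ[X]) (c : ℤ) (h0 : P.coeff 0 = 1) (h1 : P.coeff 1 = 2)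
    (h2 : P.coeff 2 = c) (i : ℕ) :
    (P ^ i).coeff 0 = 1 ∧ (P ^ i).coeff 1 = 2 * i ∧
      (P ^ i).coeff 2 = i * (2 * (i - 1) + c) := by
  induction i with
  | zero => simp [coeff_one]
  | succ i ih =>
    obtain ⟨e0, e1, e2⟩ := ih
    rw [pow_succ]
    refine ⟨?_, ?_, ?_⟩
    · simp [mul_coeff_zero, e0, h0]
    · simp [mul_coeff_one, e0, e1, h0, h1]; ring
    · rw [coeff_mul, Finset.Nat.sum_antidiagonal_eq_sum_range_succ_mk]
      simp [Finset.sum_range_succ, e0, e1, e2, h0, h1, h2]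
      ring

/-- There is a polynomial whose `k`-th power has exactly one negative coefficient, while its
higher powers up to the `K`-th have none. -/
theorem exists_polynomial_pow_coeff (k K : ℕ) (hk : 1 ≤ k) :
    ∃ P : ℤ[X], (∀ x : ℤ, 1 ≤ x → x ≤ P.eval x) ∧ ∀ i, k ≤ i → i ≤ K →
      (∀ m, m ≠ 2 → 0 ≤ (P ^ i).coeff m) ∧ 0 < (P ^ i).coeff 3 ∧
        (i = k → (P ^ i).coeff 2 < 0) ∧ (i ≠ k → 0 ≤ (P ^ i).coeff 2) := by
  have hkz : (1 : ℤ) ≤ k := by exact_mod_cast hk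
  let Q : ℤ[X] := C (4 * k ^ 2 : ℤ) * X ^ 3 + C (-(2 * k - 1) : ℤ) * X ^ 2 + C 2 * X + C 1
  let S : ℤ[X] := X ^ 2 + C (2 * k : ℤ) * X + C 1
  have hQ : Q.natDegree ≤ 3 := natDegree_cubic_le
  have hS : PosCoeffUpTo 0 S := by
    refine ⟨fun n => ?_, fun n hn => ?_⟩
    · simp only [S, coeff_add, coeff_C_mul, coeff_X_pow, coeff_X, coeff_C]
      split_ifs <;> simp <;> linarith
    · obtain rfl : n = 0 := by simpa using hn
      simp [S]
  have hSQe : S * Q = C (4 * k ^ 2 : ℤ) * X ^ 5 + C (8 * k ^ 3 - 2 * k + 1 : ℤ) * X ^ 4 +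
      C (2 * k + 2 : ℤ) * X ^ 3 + C (2 * k + 2 : ℤ) * X ^ 2 + C (2 * k + 2 : ℤ) * X + C 1 := by
    simp only [S, Q, map_add, map_sub, map_mul, map_neg, map_pow, map_ofNat, map_one]
    ring
  have hk3 : (0 : ℤ) ≤ 8 * k ^ 3 - 2 * k + 1 := by nlinarith [pow_pos (by linarith : (0:ℤ) < k) 2]
  have hSQ : PosCoeffUpTo 3 (S * Q) := by
    rw [hSQe]
    refine ⟨fun n => ?_, fun n hn => ?_⟩
    · simp only [coeff_add, coeff_C_mul, coeff_X_pow, coeff_X, coeff_C]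
      refine add_nonneg (add_nonneg (add_nonneg (add_nonneg (add_nonneg ?_ ?_) ?_) ?_) ?_) ?_
      all_goals split_ifs <;> simp <;> linarith
    · simp only [coeff_add, coeff_C_mul, coeff_X_pow, coeff_X, coeff_C]
      interval_cases n <;> norm_num <;> linarith
  have hev : ∀ᶠ M : ℤ in atTop, 0 ≤ M ∧ ∀ i ∈ Finset.Icc 1 K, ∀ m, 3 ≤ m →
      0 ≤ ((Q + C M * X ^ 3 * S ^ K) ^ i).coeff m ∧
        (m = 3 → 0 < ((Q + C M * X ^ 3 * S ^ K) ^ i).coeff m) := by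
    refine (eventually_ge_atTop 0).and ?_
    rw [Filter.eventually_all_finset]
    intro i hi
    rw [Finset.mem_Icc] at hi
    exact eventually_coeff_pow_add Q S K i hi.1 hi.2 hQ hS hSQ
  obtain ⟨M, hM0, hM⟩ := hev.exists
  refine ⟨Q + C M * X ^ 3 * S ^ K, fun x hx => ?_, fun i hki hiK => ?_⟩
  · have hSx : 0 ≤ S.eval x := by
      simp only [S, eval_add, eval_mul, eval_pow, eval_X, eval_C]
      positivity
    have hQx : x ≤ Q.eval x := by
      simp only [Q, eval_add, eval_mul, eval_pow, eval_X, eval_C]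
      have h1 : (2 * k - 1 : ℤ) ≤ 4 * k ^ 2 * x := by nlinarith
      nlinarith [mul_le_mul_of_nonneg_right h1 (sq_nonneg x)]
    simp only [eval_add, eval_mul, eval_pow, eval_X, eval_C]
    have : 0 ≤ M * x ^ 3 * (S.eval x) ^ K := by positivity
    linarith
  · have hc : ∀ n, n < 3 → (Q + C M * X ^ 3 * S ^ K).coeff n = Q.coeff n := by
      intro n hn
      rw [coeff_add, show C M * X ^ 3 * S ^ K = (C M * S ^ K) * X ^ 3 by ring, coeff_mul_X_pow',
        if_neg (by omega), add_zero]
    obtain ⟨e0, e1, e2⟩ := coeff_pow_low (Q + C M * X ^ 3 * S ^ K) (-(2 * k - 1))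
      (by rw [hc 0 (by norm_num)]; simp [Q])
      (by
        rw [hc 1 (by norm_num)]
        simp only [Q, coeff_add, coeff_C_mul, coeff_X_pow, coeff_X, coeff_C]
        simp)
      (by
        rw [hc 2 (by norm_num)]
        simp only [Q, coeff_add, coeff_C_mul, coeff_X_pow, coeff_X, coeff_C]
        simp) i
    have hMi := hM i (Finset.mem_Icc.2 ⟨by omega, hiK⟩)
    refine ⟨fun m hm => ?_, (hMi 3 le_rfl).2 rfl, ?_, ?_⟩
    · rcases Nat.lt_or_ge m 3 with h | h
      · obtain rfl | rfl : m = 0 ∨ m = 1 := by omega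
        · rw [e0]; norm_num
        · rw [e1]; positivity
      · exact (hMi m h).1
    · rintro rfl
      rw [e2]
      nlinarith
    · intro hne
      have : (k : ℤ) + 1 ≤ i := by exact_mod_cast (by omega : k + 1 ≤ i)
      rw [e2]
      exact mul_nonneg (by positivity) (by linarith)

theorem thueMorse_combination_not_eventually_periodic
    (β : ℝ) (hβ : IsPisotOrSalem β) (hgt : Real.sqrt Real.goldenRatio < β)
    (k : ℕ) (hk : 1 ≤ k) (a : ℕ → ℝ)
    (ha : ∀ i, 1 ≤ i → i ≤ k → a i ∈ IntermediateField.adjoin ℚ ({β} : Set ℝ))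
    (hne : ∃ i, 1 ≤ i ∧ i ≤ k ∧ a i ≠ 0) :
    ¬ ∃ p : ℕ, 1 ≤ p ∧ ∃ n₀ : ℕ, 1 ≤ n₀ ∧ ∀ n ≥ n₀,
      (∑ r ∈ Finset.Icc 1 k, a r * thueMorse ((n + p) ^ r)) =
      (∑ r ∈ Finset.Icc 1 k, a r * thueMorse (n ^ r)) := by
  classical
  rintro ⟨p, hp, n₀, -, hper⟩
  obtain ⟨q, ⟨hq1, hqk, hq0⟩, hmin⟩ : ∃ q, (1 ≤ q ∧ q ≤ k ∧ a q ≠ 0) ∧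
      ∀ r < q, ¬ (1 ≤ r ∧ r ≤ k ∧ a r ≠ 0) :=
    ⟨Nat.find hne, Nat.find_spec hne, fun r hr => Nat.find_min hne hr⟩
  have hconst : ∀ j ≥ n₀, (∑ r ∈ Finset.Icc 1 k, a r * thueMorse ((p * j) ^ r)) =
      ∑ r ∈ Finset.Icc 1 k, a r * thueMorse ((p * n₀) ^ r) := by
    intro j hj
    induction j, hj using Nat.le_induction with
    | base => rfl
    | succ j hj ih =>
      rw [← ih, Nat.mul_succ]
      exact hper _ (by nlinarith)
  obtain ⟨P, hPx, hP⟩ := exists_polynomial_pow_coeff q k hq1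
  have hpz : (0 : ℤ) < (p : ℤ) := by exact_mod_cast hp
  have hcoeff : ∀ i m, ((C (p : ℤ) * P) ^ i).coeff m = (p : ℤ) ^ i * (P ^ i).coeff m := by
    intro i m
    rw [mul_pow, ← C_pow, coeff_C_mul]
  have heq : ∀ᶠ A : ℕ in atTop, ∀ r ∈ Finset.Ioc q k, ∀ n n' : ℕ,
      (n : ℤ) = ((C (p : ℤ) * P) ^ r).eval (2 ^ A) →
      (n' : ℤ) = ((C (p : ℤ) * P) ^ r).eval (2 ^ (A + 1)) → thueMorse n' = thueMorse n := by
    rw [Filter.eventually_all_finset]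
    intro r hr
    rw [Finset.mem_Ioc] at hr
    obtain ⟨h, -, -, h2⟩ := hP r hr.1.le hr.2
    refine eventually_thueMorse_eval_succ_eq _ fun m => ?_
    rw [hcoeff]
    refine mul_nonneg (by positivity) ?_
    by_cases hm : m = 2
    · exact hm ▸ h2 hr.1.ne'
    · exact h m hm
  have hneq := by
    obtain ⟨h, h3, h2, -⟩ := hP q le_rfl hqk
    refine eventually_thueMorse_eval_succ_ne ((C (p : ℤ) * P) ^ q) (fun m hm => ?_) ?_ ?_
    · rw [hcoeff]
      exact mul_nonneg (by positivity) (h m hm)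
    · rw [hcoeff]
      exact mul_neg_of_pos_of_neg (by positivity) (h2 rfl)
    · rw [hcoeff]
      exact mul_pos (by positivity) h3
  obtain ⟨A, hAeq, hAne, hAn⟩ := (heq.and (hneq.and (eventually_lt_two_pow n₀))).exists
  have hval : ∀ B ≥ A, ∃ N : ℕ, n₀ ≤ N ∧
      ∀ r, (((p * N) ^ r : ℕ) : ℤ) = ((C (p : ℤ) * P) ^ r).eval (2 ^ B) := by
    intro B hB
    have h := hPx (2 ^ B) (one_le_pow₀ (by norm_num))
    have hn : (n₀ : ℤ) ≤ 2 ^ B := by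
      exact_mod_cast hAn.le.trans (Nat.pow_le_pow_right (by norm_num) hB)
    obtain ⟨N, hN⟩ := Int.eq_ofNat_of_zero_le ((Int.natCast_nonneg n₀).trans (hn.trans h))
    refine ⟨N, by exact_mod_cast (hn.trans h).trans hN.le, fun r => ?_⟩
    rw [eval_pow, eval_mul, eval_C, hN]
    push_cast
    rfl
  obtain ⟨N, hN, hNe⟩ := hval A le_rfl
  obtain ⟨N', hN', hNe'⟩ := hval (A + 1) (Nat.le_succ A)
  have hsum := (hconst N' hN').trans (hconst N hN).symm
  rw [← sub_eq_zero, ← Finset.sum_sub_distrib, Finset.sum_eq_single q] at hsum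
  · rw [← mul_sub] at hsum
    rcases mul_eq_zero.1 hsum with h | h
    · exact hq0 h
    · exact hAne _ _ (hNe q) (hNe' q) (by exact_mod_cast sub_eq_zero.1 h)
  · intro r hr hrq
    rw [Finset.mem_Icc] at hr
    rcases lt_or_gt_of_ne hrq with h | h
    · have : a r = 0 := by
        by_contra h0
        exact hmin r h ⟨hr.1, hr.2, h0⟩
      simp [this]
    · rw [hAeq r (Finset.mem_Ioc.2 ⟨h, hr.2⟩) _ _ (hNe r) (hNe' r), sub_self]
  · intro h
    exact absurd (Finset.mem_Icc.2 ⟨hq1, hqk⟩) h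
end
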